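/- Let n ≥ 1 and let γ, ϑ : ℝⁿ → ℝⁿ be smooth (the components of one-forms γ = γₖ dqᵏ and ϑ = ϑᵢ dqⁱ on ℝⁿ). On ℝⁿ × ℝⁿ define the two-form Ω_θ = dqⁱ∧dpᵢ + θ∧Θ_Q, where θ = ϑᵢ(q) dqⁱ and Θ_Q = pᵢ dqⁱ; explicitly, Ω_θ(q,p)((u_q,u_p),(v_q,v_p)) = ⟨u_q,v_p⟩ − ⟨u_p,v_q⟩ + ⟨ϑ(q),u_q⟩⟨p,v_q⟩ − ⟨ϑ(q),v_q⟩⟨p,u_q⟩. Then the pullback of Ω_θ under Γ(q) = (q, γ(q)) equals −d_ϑγ: for all q and all u, v ∈ ℝⁿ, Ω_θ(Γ(q))(DΓ(q)u, DΓ(q)v) = −[ (⟨v, Dγ(q)u⟩ − ⟨u, Dγ(q)v⟩) − (⟨ϑ(q),u⟩⟨γ(q),v⟩ − ⟨ϑ(q),v⟩⟨γ(q),u⟩) ]. Consequently the image of γ is a Lagrangian submanifold of the locally conformally symplectic structure (ℝ²ⁿ, Ω_θ, θ) if and only if d_ϑγ = 0. -/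

import Mathlib

noncomputable section

/-- The locally conformally symplectic two-form `Ω_θ = dqⁱ∧dpᵢ + θ∧Θ_Q` on
`ℝⁿ × ℝⁿ`, evaluated at a point `w = (q,p)` on a pair of tangent vectors. -/
def OmegaTheta (n : ℕ) (ϑ : (Fin n → ℝ) → (Fin n → ℝ))
    (w : (Fin n → ℝ) × (Fin n → ℝ)) (U V : (Fin n → ℝ) × (Fin n → ℝ)) : ℝ :=
  (∑ i, U.1 i * V.2 i) - (∑ i, U.2 i * V.1 i)
    + (∑ i, ϑ w.1 i * U.1 i) * (∑ i, w.2 i * V.1 i)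
    - (∑ i, ϑ w.1 i * V.1 i) * (∑ i, w.2 i * U.1 i)

/-- The pullback of `Ω_θ` under `Γ(q) = (q, γ(q))` equals `−d_ϑγ`, where `d_ϑ` is the
Lichnerowicz–de Rham differential `d_ϑγ = dγ − ϑ∧γ`. Hence the image of `γ` is
Lagrangian in the LCS structure iff `d_ϑγ = 0`. -/
theorem stmt_8 (n : ℕ) (hn : 1 ≤ n)
    (γ ϑ : (Fin n → ℝ) → (Fin n → ℝ)) (hγ : ContDiff ℝ (⊤ : ℕ∞) γ) (hϑ : ContDiff ℝ (⊤ : ℕ∞) ϑ) :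
    ∀ (q u v : Fin n → ℝ),
      OmegaTheta n ϑ (q, γ q)
        (fderiv ℝ (fun q' => ((q', γ q') : (Fin n → ℝ) × (Fin n → ℝ))) q u)
        (fderiv ℝ (fun q' => ((q', γ q') : (Fin n → ℝ) × (Fin n → ℝ))) q v) =
      -(((∑ i, v i * fderiv ℝ γ q u i) - ∑ i, u i * fderiv ℝ γ q v i) -
        ((∑ i, ϑ q i * u i) * (∑ i, γ q i * v i) -
         (∑ i, ϑ q i * v i) * (∑ i, γ q i * u i))) := by
  intro q u v
  have hd : DifferentiableAt ℝ γ q := (hγ.differentiable (by simp)) q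
  have hΓ : fderiv ℝ (fun q' => ((q', γ q') : (Fin n → ℝ) × (Fin n → ℝ))) q =
      (ContinuousLinearMap.id ℝ (Fin n → ℝ)).prod (fderiv ℝ γ q) :=
    ((hasFDerivAt_id q).prodMk hd.hasFDerivAt).fderiv
  have hcomm : ∑ i, fderiv ℝ γ q u i * v i = ∑ i, v i * fderiv ℝ γ q u i :=
    Finset.sum_congr rfl fun i _ => mul_comm _ _
  simp only [hΓ, OmegaTheta, ContinuousLinearMap.prod_apply, ContinuousLinearMap.id_apply, hcomm]
  ring
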